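/- For any set X ⊆ ℕ and any n ≥ 2, the following are equivalent: X ≤_bT ∅^{nb}; X is ω^n-c.e.; X ≤₁ ∅^{nb}. -/

import Mathlib

open Classical

/-- Characteristic function of a set of naturals (values in `{0,1}`). -/
noncomputable def chi (A : Set ℕ) (n : ℕ) : ℕ := if n ∈ A then 1 else 0

/-- An acceptable enumeration `φ_e` of the partial computable functions,
via Mathlib's codes for partial recursive functions. -/
def phi (e : ℕ) : ℕ →. ℕ := (Denumerable.ofNat Nat.Partrec.Code e).eval

/-- The initial segment of (the characteristic function of) `A` of length `n`,
as a list of naturals. -/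
noncomputable def initSeg (A : Set ℕ) (n : ℕ) : List ℕ := (List.range n).map (chi A)

/-- An effective enumeration `Φ_e` of the Turing functionals: the `e`-th functional
with oracle `A` on input `x` converges iff the `e`-th partial computable function halts
on `(σ, x)` for some initial segment `σ` of `A`; its value is obtained from the least
such initial segment. -/
noncomputable def Phi (e : ℕ) (A : Set ℕ) (x : ℕ) : Part ℕ :=
  ⟨∃ n, (phi e (Nat.pair (Encodable.encode (initSeg A n)) x)).Dom,
   fun h => (phi e (Nat.pair (Encodable.encode (initSeg A (Nat.find h))) x)).get (Nat.find_spec h)⟩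

/-- `A↾n = {m ∈ A : m ≤ n}`. -/
def restrictTo (A : Set ℕ) (n : ℕ) : Set ℕ := {m | m ∈ A ∧ m ≤ n}

/-- The bounded jump `A^b = {x : ∃ i ≤ x, φ_i(x)↓ ∧ Φ_x^{A↾φ_i(x)}(x)↓}`. -/
def bJump (A : Set ℕ) : Set ℕ :=
  {x | ∃ i ≤ x, ∃ h : (phi i x).Dom, (Phi x (restrictTo A ((phi i x).get h)) x).Dom}

/-- `A^{b₀} = {⟨e,i,j⟩ : φ_i(j)↓ ∧ Φ_e^{A↾φ_i(j)}(j)↓}`, coding triples with `Nat.pair`. -/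
def b0Jump (A : Set ℕ) : Set ℕ :=
  {n | ∃ e i j, n = Nat.pair e (Nat.pair i j) ∧
        ∃ h : (phi i j).Dom, (Phi e (restrictTo A ((phi i j).get h)) j).Dom}

/-- The simple jump `A^i = {x : Φ_x^{A↾x}(x)↓}`. -/
def iJump (A : Set ℕ) : Set ℕ := {x | (Phi x (restrictTo A x) x).Dom}

/-- `∅^{nb}`, the `n`-th iterate of the bounded jump of the empty set. -/
def bIter : ℕ → Set ℕ
  | 0 => (∅ : Set ℕ)
  | n + 1 => bJump (bIter n)

/-- The halting set `∅′ = {x : φ_x(x)↓}`. -/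
def K : Set ℕ := {x | (phi x x).Dom}

/-- The effective join `A ⊕ B = {2n : n ∈ A} ∪ {2n+1 : n ∈ B}`. -/
def join (A B : Set ℕ) : Set ℕ :=
  {n | (∃ m ∈ A, n = 2 * m) ∨ (∃ m ∈ B, n = 2 * m + 1)}

/-- `X ≤₁ Y`: one-reducibility via a total computable injection. -/
def oneReducible (X Y : Set ℕ) : Prop :=
  ∃ f : ℕ → ℕ, Computable f ∧ Function.Injective f ∧ ∀ x, x ∈ X ↔ f x ∈ Y

/-- `X ≤_bT Y`: bounded Turing (weak truth-table) reducibility. There are indices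
`e, j` with `φ_j` total such that `X(x) = Φ_e^{Y↾φ_j(x)}(x)` for all `x`. -/
def bTReducible (X Y : Set ℕ) : Prop :=
  ∃ e j, ∃ h : ∀ x, (phi j x).Dom,
    ∀ x, Phi e (restrictTo Y ((phi j x).get (h x))) x = Part.some (chi X x)

/-- `X ≤_T Y`: Turing reducibility. -/
def TReducible (X Y : Set ℕ) : Prop :=
  ∃ e, ∀ x, Phi e Y x = Part.some (chi X x)

/-- `X ≤_tt Y`: truth-table reducibility, i.e. Turing reducibility via a functional
that is total on all oracles. -/
def ttReducible (X Y : Set ℕ) : Prop :=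
  ∃ e, (∀ B : Set ℕ, ∀ x, (Phi e B x).Dom) ∧ ∀ x, Phi e Y x = Part.some (chi X x)

/-- `A` is `ω^k`-c.e.: ordinals below `ω^k` are coded by their lists of Cantor normal
form coefficients (length-`k` lists of naturals, most significant first), ordered
lexicographically.  There is a partial computable `ψ : ℕ × ω^k → {0,1}` such that for
every `n` some `ψ(n,β)` converges, and `A(n) = ψ(n,γ)` for the least converging `γ`. -/
def OmegaCE (k : ℕ) (A : Set ℕ) : Prop :=
  ∃ ψ : ℕ →. ℕ, Partrec ψ ∧ (∀ m y, y ∈ ψ m → y ≤ 1) ∧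
    ∀ n : ℕ, ∃ l : List ℕ, l.length = k ∧
      (∀ l' : List ℕ, l'.length = k → List.Lex (· < ·) l' l →
        ¬ (ψ (Nat.pair n (Encodable.encode l'))).Dom) ∧
      chi A n ∈ ψ (Nat.pair n (Encodable.encode l))

/-- The (lightface) `Σ_n` sets of naturals. -/
def SigmaN : ℕ → Set ℕ → Prop
  | 0 => fun S => ComputablePred (· ∈ S)
  | n + 1 => fun S => ∃ R : Set ℕ, SigmaN n R ∧ S = {x | ∃ y, Nat.pair x y ∉ R}

/-- The initial segment of `A` of length `n`, as a finite binary string. -/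
noncomputable def initSegB (A : Set ℕ) (n : ℕ) : List Bool :=
  (List.range n).map fun i => decide (i ∈ A)

/-- `A` is `n`-generic: for every `Σ_n` set `S` of (codes of) finite binary strings,
either some initial segment of `A` is in `S`, or some initial segment of `A` has no
extension in `S`. -/
def NGeneric (n : ℕ) (A : Set ℕ) : Prop :=
  ∀ S : Set ℕ, SigmaN n S →
    (∃ l, Encodable.encode (initSegB A l) ∈ S) ∨
    (∃ l, ∀ τ : List Bool, initSegB A l <+: τ → Encodable.encode τ ∉ S)

/-- The open subset of Cantor space generated by the set of strings `U` has measure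
`≤ 2^{-i}`: for every `n`, at most `2^n/2^i` strings of length `n` extend a string
of `U`. -/
def stringMeasureLe (U : Set (List Bool)) (i : ℕ) : Prop :=
  ∀ n : ℕ, ({σ : List Bool | σ.length = n ∧ ∃ τ ∈ U, τ <+: σ}.ncard) * 2 ^ i ≤ 2 ^ n

/-- `A` is `n`-random: for every uniformly `Σ_n` family `⟨U_i⟩` of sets of (codes of)
finite binary strings with `μ(U_i) ≤ 2^{-i}`, there is an `l` such that no initial
segment of `A` lies in `U_l`. -/
def NRandom (n : ℕ) (A : Set ℕ) : Prop :=
  ∀ U : Set ℕ, SigmaN n U →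
    (∀ i, stringMeasureLe {σ : List Bool | Nat.pair i (Encodable.encode σ) ∈ U} i) →
    ∃ l, ∀ m, Nat.pair l (Encodable.encode (initSegB A m)) ∉ U

/-- The code `c` codes a tt-condition (a finite sequence of positions together with a
truth table) satisfied by `A`. -/
def ttSatisfied (A : Set ℕ) (c : ℕ) : Prop :=
  ∃ p : List ℕ × List Bool, Encodable.decode c = some p ∧
    p.2.length = 2 ^ p.1.length ∧
    p.2.getD (p.1.foldr (fun x acc => 2 * acc + chi A x) 0) false = true

/-- `A^{tt}`: the set of codes of tt-conditions satisfied by `A`. -/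
def ttSet (A : Set ℕ) : Set ℕ := {c | ttSatisfied A c}

/-- Gerla's truth-table jump `A_tt = {x : φ_x(x)↓ ∧ φ_x(x) ∈ A^{tt}}`. -/
def gerlaJump (A : Set ℕ) : Set ℕ :=
  {x | ∃ h : (phi x x).Dom, (phi x x).get h ∈ ttSet A}

namespace BoundedJump

open Nat.Partrec (Code)

section Computability

variable {α : Type*} [Primcodable α]

theorem computable_map_range {σ : Type*} [Primcodable σ] {N : α → ℕ} {f : α → ℕ → σ}
    (hN : Computable N) (hf : Computable₂ f) :
    Computable fun a => (List.range (N a)).map (f a) := by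
  refine (Computable.nat_rec (h := fun a p => p.2 ++ [f a p.1]) hN (Computable.const [])
    (Computable.list_concat.comp (Computable.snd.comp Computable.snd)
      (hf.comp Computable.fst (Computable.fst.comp Computable.snd))).to₂).of_eq fun a => ?_
  induction N a with
  | zero => rfl
  | succ k ih => simp only [ih, List.range_succ, List.map_append, List.map_cons, List.map_nil]

theorem computable_sum_range {N : α → ℕ} {f : α → ℕ → ℕ}
    (hN : Computable N) (hf : Computable₂ f) :
    Computable fun a => ∑ i ∈ Finset.range (N a), f a i := by
  refine (Computable.nat_rec (h := fun a p => p.2 + f a p.1) hN (Computable.const 0)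
    (Primrec.nat_add.to_comp.comp (Computable.snd.comp Computable.snd)
      (hf.comp Computable.fst (Computable.fst.comp Computable.snd))).to₂).of_eq fun a => ?_
  induction N a with
  | zero => rfl
  | succ k ih => simp only [ih, Finset.sum_range_succ]

theorem computable_natPair {f g : α → ℕ} (hf : Computable f) (hg : Computable g) :
    Computable fun a => Nat.pair (f a) (g a) :=
  Primrec₂.natPair.to_comp.comp hf hg

theorem computable_add {f g : α → ℕ} (hf : Computable f) (hg : Computable g) :
    Computable fun a => f a + g a :=
  Primrec.nat_add.to_comp.comp hf hg

theorem computable_unpair_fst {f : α → ℕ} (hf : Computable f) :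
    Computable fun a => (f a).unpair.1 :=
  Computable.fst.comp (Computable.unpair.comp hf)

theorem computable_unpair_snd {f : α → ℕ} (hf : Computable f) :
    Computable fun a => (f a).unpair.2 :=
  Computable.snd.comp (Computable.unpair.comp hf)

theorem computable_decide_lt {f g : α → ℕ} (hf : Computable f) (hg : Computable g) :
    Computable fun a => Nat.blt (f a) (g a) := by
  refine ((Primrec.nat_lt.decide).to_comp.comp hf hg).of_eq fun a => ?_
  rw [Bool.eq_iff_iff]; simp

theorem computable_decide_eq {f g : α → ℕ} (hf : Computable f) (hg : Computable g) :
    Computable fun a => Nat.beq (f a) (g a) := by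
  refine ((Primrec.eq (α := ℕ)).decide.to_comp.comp hf hg).of_eq fun a => ?_
  rw [Bool.eq_iff_iff]; simp

theorem computable_and {f g : α → Bool} (hf : Computable f) (hg : Computable g) :
    Computable fun a => f a && g a :=
  Primrec.and.to_comp.comp hf hg

theorem computable_or {f g : α → Bool} (hf : Computable f) (hg : Computable g) :
    Computable fun a => f a || g a :=
  Primrec.or.to_comp.comp hf hg

theorem computable_not {f : α → Bool} (hf : Computable f) : Computable fun a => !f a :=
  Primrec.not.to_comp.comp hf

theorem computable_isSome {σ : Type*} [Primcodable σ] {f : α → Option σ} (hf : Computable f) :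
    Computable fun a => (f a).isSome :=
  Primrec.option_isSome.to_comp.comp hf

theorem computable_listGetD {σ : Type*} [Primcodable σ] (d : σ) {f : α → List σ} {g : α → ℕ}
    (hf : Computable f) (hg : Computable g) : Computable fun a => (f a).getD (g a) d :=
  (Primrec.list_getD d).to_comp.comp hf hg

theorem computable_headI {f : α → List ℕ} (hf : Computable f) :
    Computable fun a => (f a).headI :=
  Primrec.list_headI.to_comp.comp hf

theorem computable_tail {f : α → List ℕ} (hf : Computable f) :
    Computable fun a => (f a).tail :=
  Primrec.list_tail.to_comp.comp hf

theorem computable_evaln {k x : α → ℕ} {c : α → Code} (hk : Computable k) (hc : Computable c)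
    (hx : Computable x) : Computable fun a => Code.evaln (k a) (c a) (x a) :=
  Code.primrec_evaln.to_comp.comp ((hk.pair hc).pair hx)

end Computability

section Lex

/-- The lexicographic order on lists of naturals. -/
abbrev LexLT (l l' : List ℕ) : Prop := List.Lex (· < ·) l l'

theorem lexLT_irrefl (l : List ℕ) : ¬ LexLT l l := fun h =>
  lt_irrefl l h

theorem lexLT_trans {a b c : List ℕ} (h : LexLT a b) (h' : LexLT b c) : LexLT a c :=
  lt_trans (α := List ℕ) h h'

theorem lexLT_trichotomy (a b : List ℕ) : LexLT a b ∨ a = b ∨ LexLT b a :=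
  lt_trichotomy (α := List ℕ) a b

theorem lexLT_cons_cons {a b : ℕ} {l l' : List ℕ} :
    LexLT (a :: l) (b :: l') ↔ a < b ∨ a = b ∧ LexLT l l' :=
  List.cons_lt_cons_iff (α := ℕ)

theorem exists_lex_minimal {n : ℕ} {S : Set (List ℕ)} (hS : ∀ l ∈ S, l.length = n)
    (hne : S.Nonempty) : ∃ l ∈ S, ∀ l' ∈ S, ¬ LexLT l' l := by
  obtain ⟨l, hl, hmin⟩ := (List.Shortlex.wf (wellFounded_lt (α := ℕ))).has_min S hne
  refine ⟨l, hl, fun l' hl' h => hmin l' hl' ?_⟩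
  exact List.Shortlex.of_lex ((hS l' hl').trans (hS l hl).symm) h

theorem lexLT_iff_getD {n : ℕ} : ∀ {l l' : List ℕ}, l.length = n → l'.length = n →
    (LexLT l l' ↔ ∃ i < n, (∀ j < i, l.getD j 0 = l'.getD j 0) ∧ l.getD i 0 < l'.getD i 0) := by
  induction n with
  | zero =>
    intro l l' h h'
    rw [List.length_eq_zero_iff] at h h'
    subst h h'
    simp
  | succ n ih =>
    rintro (_ | ⟨a, l⟩) (_ | ⟨b, l'⟩) h h' <;> simp only [List.length_cons, List.length_nil,
      Nat.add_right_cancel_iff, Nat.zero_ne_add_one] at h h'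
    have ih' := ih h h'
    constructor
    · intro hl
      rcases lexLT_cons_cons.1 hl with hr | ⟨rfl, hc⟩
      · exact ⟨0, by omega, by simp, by simpa using hr⟩
      · obtain ⟨i, hi, h1, h2⟩ := ih'.1 hc
        refine ⟨i + 1, by omega, ?_, by simpa using h2⟩
        rintro (_ | j) hj
        · simp
        · simpa using h1 j (by omega)
    · rintro ⟨_ | i, hi, h1, h2⟩
      · exact List.Lex.rel (by simpa using h2)
      · have h0 : a = b := by simpa using h1 0 (by omega)
        subst h0
        refine List.Lex.cons (ih'.2 ⟨i, by omega, fun j hj => ?_, by simpa using h2⟩)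
        simpa using h1 (j + 1) (by omega)

/-- Boolean lexicographic comparison of the first `n` entries. -/
def lexB : ℕ → List ℕ → List ℕ → Bool
  | 0, _, _ => false
  | n + 1, l, l' => Nat.blt l.headI l'.headI || (Nat.beq l.headI l'.headI && lexB n l.tail l'.tail)

theorem lexB_iff : ∀ {n : ℕ} {l l' : List ℕ}, l.length = n → l'.length = n →
    (lexB n l l' = true ↔ LexLT l l') := by
  intro n
  induction n with
  | zero =>
    intro l l' h h'
    rw [List.length_eq_zero_iff] at h h'
    subst h h'
    simp [lexB]
  | succ n ih =>
    rintro (_ | ⟨a, l⟩) (_ | ⟨b, l'⟩) h h' <;> simp only [List.length_cons, List.length_nil,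
      Nat.add_right_cancel_iff, Nat.zero_ne_add_one] at h h'
    rw [lexLT_cons_cons]
    simp only [lexB, Bool.or_eq_true, Bool.and_eq_true, List.headI, List.tail, ih h h',
      Nat.blt_eq, Nat.beq_eq]

theorem computable_lexB (n : ℕ) : Computable₂ (lexB n) := by
  induction n with
  | zero => exact Computable.const false
  | succ n ih =>
    have h1 := computable_headI (Computable.fst (α := List ℕ) (β := List ℕ))
    have h2 := computable_headI (Computable.snd (α := List ℕ) (β := List ℕ))
    exact computable_or (computable_decide_lt h1 h2) (computable_and (computable_decide_eq h1 h2)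
      (ih.comp (computable_tail Computable.fst) (computable_tail Computable.snd)))

end Lex

section Approximation

/-- A computable approximation `h` together with a computable rank `r` taking values in the
length-`n` lists, such that the rank drops lexicographically whenever the value changes. -/
structure RankedProcess (n : ℕ) (h : ℕ → ℕ → Bool) (r : ℕ → ℕ → List ℕ) : Prop where
  computable_value : Computable₂ h
  computable_rank : Computable₂ r
  length_rank : ∀ x s, (r x s).length = n
  step : ∀ x s, (r x (s + 1) = r x s ∧ h x (s + 1) = h x s) ∨ LexLT (r x (s + 1)) (r x s)

/-- `X` is the limit of a ranked process with ranks below `ω ^ n`. -/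
def HasApprox (n : ℕ) (X : Set ℕ) : Prop :=
  ∃ h r, RankedProcess n h r ∧ ∀ x, ∃ s₀, ∀ s ≥ s₀, (h x s = true ↔ x ∈ X)

theorem RankedProcess.step_le {n : ℕ} {h : ℕ → ℕ → Bool} {r : ℕ → ℕ → List ℕ}
    (H : RankedProcess n h r) (x : ℕ) {s t : ℕ} (hst : s ≤ t) :
    (r x t = r x s ∧ h x t = h x s) ∨ LexLT (r x t) (r x s) := by
  induction t, hst using Nat.le_induction with
  | base => exact .inl ⟨rfl, rfl⟩
  | succ t _ ih =>
    rcases H.step x t with ⟨h1, h2⟩ | h1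
    · rwa [h1, h2]
    · rcases ih with ⟨h3, -⟩ | h3
      · exact .inr (h3 ▸ h1)
      · exact .inr (lexLT_trans h1 h3)

theorem mem_rfind_some {p : ℕ → Bool} {s : ℕ} :
    s ∈ Nat.rfind (fun t => Part.some (p t)) ↔ p s = true ∧ ∀ t < s, p t = false :=
  Nat.mem_rfind.trans (by simp only [Part.mem_some_iff, eq_comm])

theorem exists_mem_rfind_some {p : ℕ → Bool} (hp : ∃ s, p s = true) :
    ∃ s, s ∈ Nat.rfind (fun t => Part.some (p t)) := by
  refine ⟨Nat.find hp, mem_rfind_some.2 ⟨Nat.find_spec hp, fun t ht => ?_⟩⟩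
  simpa using Nat.find_min hp ht

theorem partrec_rfind_some {α : Type*} [Primcodable α] {p : α → ℕ → Bool} (hp : Computable₂ p) :
    Partrec fun a => Nat.rfind (fun t => Part.some (p a t)) :=
  Partrec.rfind hp.partrec₂

theorem chi_eq_one_iff {X : Set ℕ} {x : ℕ} : chi X x = 1 ↔ x ∈ X := by
  unfold chi; split_ifs with h <;> simp [h]

theorem chi_eq_toNat {X : Set ℕ} {x : ℕ} {b : Bool} (hb : b = true ↔ x ∈ X) :
    chi X x = b.toNat := by
  unfold chi; split_ifs with h <;> cases b <;> simp_all

theorem HasApprox.omegaCE {n : ℕ} {X : Set ℕ} (hX : HasApprox n X) : OmegaCE n X := by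
  obtain ⟨h, r, H, hlim⟩ := hX
  have hmem : ∀ x (l : List ℕ) s, s ∈ Nat.rfind (fun s => Part.some
      (Nat.beq (Encodable.encode (r x s)) (Encodable.encode l))) ↔
      r x s = l ∧ ∀ t < s, r x t ≠ l := by
    intro x l s
    rw [mem_rfind_some]
    simp [← Bool.not_eq_true, Nat.beq_eq]
  refine ⟨fun m => (Nat.rfind (fun s => Part.some
    (Nat.beq (Encodable.encode (r m.unpair.1 s)) m.unpair.2))).map
      fun s => (h m.unpair.1 s).toNat, ?_, ?_, fun x => ?_⟩
  · refine Partrec.map (partrec_rfind_some (computable_decide_eq ?_ ?_)) ?_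
    · exact Computable.encode.comp (H.computable_rank.comp
        (computable_unpair_fst Computable.fst) Computable.snd)
    · exact computable_unpair_snd Computable.fst
    · exact (Primrec.dom_bool Bool.toNat).to_comp.comp (H.computable_value.comp
        (computable_unpair_fst Computable.fst) Computable.snd)
  · intro m y hy
    obtain ⟨s, -, rfl⟩ := (Part.mem_map_iff _).1 hy
    exact Bool.toNat_le _
  · obtain ⟨l, ⟨s₁, rfl⟩, hmin⟩ := exists_lex_minimal (S := Set.range (r x))
      (by rintro _ ⟨s, rfl⟩; exact H.length_rank x s) ⟨_, 0, rfl⟩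
    refine ⟨r x s₁, H.length_rank x s₁, ?_, ?_⟩
    · intro l' _ hl' hdom
      simp only [Nat.unpair_pair, Part.map_Dom] at hdom
      obtain ⟨s, hs⟩ := Part.dom_iff_mem.1 hdom
      exact hmin _ ⟨s, ((hmem x l' s).1 hs).1⟩ hl'
    · obtain ⟨s, hs⟩ := exists_mem_rfind_some
        (p := fun s => Nat.beq (Encodable.encode (r x s)) (Encodable.encode (r x s₁)))
        ⟨s₁, by simp⟩
      have hs' := ((hmem x _ s).1 hs).1
      obtain ⟨s₀, hs₀⟩ := hlim x
      simp only [Nat.unpair_pair, Part.mem_map_iff]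
      refine ⟨s, hs, ?_⟩
      rcases H.step_le x (le_max_left s s₀) with ⟨-, h2⟩ | h2
      · rw [← h2]
        exact (chi_eq_toNat (hs₀ _ (le_max_right _ _))).symm
      · exact absurd (hs' ▸ h2) (hmin _ ⟨_, rfl⟩)

theorem OmegaCE.hasApprox {n : ℕ} {X : Set ℕ} (hX : OmegaCE n X) : HasApprox n X := by
  obtain ⟨ψ, hψ, -, hX⟩ := hX
  obtain ⟨c, rfl⟩ := Code.exists_code.1 (Partrec.nat_iff.1 hψ)
  set L : ℕ → List ℕ := fun t => Denumerable.ofNat (List ℕ) t.unpair.1 with hL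
  set ev : ℕ → ℕ → Option ℕ :=
    fun x t => Code.evaln t.unpair.2 c (Nat.pair x t.unpair.1) with hev
  set conv : ℕ → ℕ → Bool := fun x t => Nat.beq (L t).length n && (ev x t).isSome with hconv
  have hLc : Computable L := (Computable.ofNat _).comp (computable_unpair_fst Computable.id)
  have hevc : Computable₂ ev := computable_evaln (computable_unpair_snd Computable.snd)
    (Computable.const c) (computable_natPair Computable.fst (computable_unpair_fst Computable.snd))
  have hconvc : Computable₂ conv :=
    computable_and (computable_decide_eq (Computable.list_length.comp (hLc.comp Computable.snd))
      (Computable.const n)) (computable_isSome hevc)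
  have henc : ∀ t, Encodable.encode (L t) = t.unpair.1 := fun t => Denumerable.encode_ofNat _
  have hdom : ∀ x l v, v ∈ c.eval (Nat.pair x (Encodable.encode l)) → l.length = n →
      ∃ t, L t = l ∧ conv x t = true := by
    intro x l v hv hl
    obtain ⟨k, hk⟩ := Code.evaln_complete.1 hv
    refine ⟨Nat.pair (Encodable.encode l) k, by simp [hL], ?_⟩
    simp only [hconv, hL, hev, Nat.unpair_pair, Denumerable.ofNat_encode, Bool.and_eq_true,
      Nat.beq_eq]
    exact ⟨hl, Option.isSome_iff_exists.2 ⟨v, hk⟩⟩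
  have hex : ∀ x, ∃ t, t ∈ Nat.rfind (fun t => Part.some (conv x t)) := by
    intro x
    obtain ⟨l, hl, -, hv⟩ := hX x
    obtain ⟨t, -, ht⟩ := hdom x l _ hv hl
    exact exists_mem_rfind_some ⟨t, ht⟩
  choose t₀ ht₀ using hex
  have ht₀c : Computable t₀ := Partrec.of_eq_tot (partrec_rfind_some hconvc) ht₀
  set st : ℕ → ℕ → ℕ := fun x s => Nat.rec (t₀ x)
    (fun s q => cond (conv x s && lexB n (L s) (L q)) s q) s with hst
  have hstc : Computable₂ st := by
    refine Computable.nat_rec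
      (h := fun (a : ℕ × ℕ) p => cond (conv a.1 p.1 && lexB n (L p.1) (L p.2)) p.1 p.2)
      Computable.snd (ht₀c.comp Computable.fst) ?_
    have h1 : Computable fun p : (ℕ × ℕ) × (ℕ × ℕ) => p.2.1 :=
      Computable.fst.comp Computable.snd
    have h2 : Computable fun p : (ℕ × ℕ) × (ℕ × ℕ) => p.2.2 :=
      Computable.snd.comp Computable.snd
    exact Computable.cond (computable_and
      (hconvc.comp (Computable.fst.comp Computable.fst) h1)
      ((computable_lexB n).comp (hLc.comp h1) (hLc.comp h2))) h1 h2
  have hst1 : ∀ x s, st x (s + 1) =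
      cond (conv x s && lexB n (L s) (L (st x s))) s (st x s) := fun x s => rfl
  have hinv : ∀ x s, conv x (st x s) = true := by
    intro x s
    induction s with
    | zero => exact (mem_rfind_some.1 (ht₀ x)).1
    | succ s ih =>
      rw [hst1]
      cases hc : (conv x s && lexB n (L s) (L (st x s)))
      · exact ih
      · exact (Bool.and_eq_true_iff.1 hc).1
  have hlen : ∀ x t, conv x t = true → (L t).length = n := fun x t h => by
    simp only [hconv, Bool.and_eq_true, Nat.beq_eq] at h
    exact h.1
  have H : RankedProcess n (fun x s => Nat.beq ((ev x (st x s)).getD 0) 1)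
      (fun x s => L (st x s)) := by
    refine ⟨computable_decide_eq (Computable.option_getD (hevc.comp Computable.fst hstc)
      (Computable.const 0)) (Computable.const 1), hLc.comp hstc, fun x s => hlen x _ (hinv x s), ?_⟩
    intro x s
    simp only [hst1]
    cases hc : (conv x s && lexB n (L s) (L (st x s)))
    · exact .inl ⟨rfl, rfl⟩
    · rw [Bool.and_eq_true] at hc
      exact .inr ((lexB_iff (hlen x _ hc.1) (hlen x _ (hinv x s))).1 hc.2)
  refine ⟨_, _, H, fun x => ?_⟩
  obtain ⟨l, hl, hmin, hv⟩ := hX x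
  obtain ⟨t, rfl, ht⟩ := hdom x l _ hv hl
  have hbelow : ∀ s ≥ t + 1, ¬ LexLT (L t) (L (st x s)) := by
    intro s hs hlt
    have h1 : ¬ LexLT (L t) (L (st x (t + 1))) := by
      rw [hst1, ht, Bool.true_and]
      cases hc : lexB n (L t) (L (st x t))
      · rw [cond_false, ← lexB_iff hl (hlen x _ (hinv x t)), hc]
        simp
      · exact lexLT_irrefl _
    rcases H.step_le x hs with ⟨h2, -⟩ | h2
    · exact h1 (h2 ▸ hlt)
    · exact h1 (lexLT_trans hlt h2)
  refine ⟨t + 1, fun s hs => ?_⟩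
  obtain ⟨v, hv'⟩ := Option.isSome_iff_exists.1 (Bool.and_eq_true_iff.1 (hinv x s)).2
  have hvm : v ∈ c.eval (Nat.pair x (Encodable.encode (L (st x s)))) := by
    rw [henc]; exact Code.evaln_sound (Option.mem_def.2 hv')
  rcases lexLT_trichotomy (L (st x s)) (L t) with h1 | h1 | h1
  · exact absurd (Part.dom_iff_mem.2 ⟨v, hvm⟩) (hmin _ (hlen x _ (hinv x s)) h1)
  · rw [h1] at hvm
    rw [hv', Option.getD_some, Nat.beq_eq, Part.mem_unique hvm hv, chi_eq_one_iff]
  · exact absurd h1 (hbelow s hs)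

/-- Truth-table reducibility via a computable use bound and a total computable evaluation. -/
def TTRed (X A : Set ℕ) : Prop :=
  ∃ (u : ℕ → ℕ) (d : ℕ → List Bool → Bool), Computable u ∧ Computable₂ d ∧
    ∀ x, x ∈ X ↔ d x (initSegB A (u x)) = true

theorem initSegB_getD {A : Set ℕ} {u i : ℕ} (hi : i < u) :
    (initSegB A u).getD i false = decide (i ∈ A) := by
  simp [initSegB, List.getD, hi]

theorem initSegB_getD_eq_true {A : Set ℕ} {u i : ℕ} (hi : i < u) :
    (initSegB A u).getD i false = true ↔ i ∈ A := by
  rw [initSegB_getD hi, decide_eq_true_iff]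

theorem HasApprox.succ {n : ℕ} {X : Set ℕ} (hX : HasApprox n X) : HasApprox (n + 1) X := by
  obtain ⟨h, r, H, hlim⟩ := hX
  refine ⟨h, fun x s => 0 :: r x s, ⟨H.computable_value, Computable.list_cons.comp
    (Computable.const 0) H.computable_rank, fun x s => by simp [H.length_rank], fun x s => ?_⟩,
    hlim⟩
  rcases H.step x s with ⟨h1, h2⟩ | h1
  · exact .inl ⟨by rw [h1], h2⟩
  · exact .inr (List.Lex.cons h1)

theorem HasApprox.mono {m n : ℕ} {X : Set ℕ} (hX : HasApprox m X) (hmn : m ≤ n) :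
    HasApprox n X := by
  induction n, hmn using Nat.le_induction with
  | base => exact hX
  | succ n _ ih => exact ih.succ

theorem HasApprox.preimage {n : ℕ} {X : Set ℕ} (hX : HasApprox n X) {f : ℕ → ℕ}
    (hf : Computable f) : HasApprox n (f ⁻¹' X) := by
  obtain ⟨h, r, H, hlim⟩ := hX
  have hf' : Computable fun p : ℕ × ℕ => f p.1 := hf.comp Computable.fst
  exact ⟨fun x => h (f x), fun x => r (f x), ⟨H.computable_value.comp hf' Computable.snd,
    H.computable_rank.comp hf' Computable.snd, fun x => H.length_rank (f x),
    fun x => H.step (f x)⟩, fun x => hlim (f x)⟩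

theorem double_mem_join {A B : Set ℕ} {m : ℕ} : m + m ∈ join A B ↔ m ∈ A := by
  constructor
  · rintro (⟨k, hk, h⟩ | ⟨k, hk, h⟩)
    · obtain rfl : m = k := by omega
      exact hk
    · omega
  · exact fun h => .inl ⟨m, h, by omega⟩

theorem double_succ_mem_join {A B : Set ℕ} {m : ℕ} : m + m + 1 ∈ join A B ↔ m ∈ B := by
  constructor
  · rintro (⟨k, hk, h⟩ | ⟨k, hk, h⟩)
    · omega
    · obtain rfl : m = k := by omega
      exact hk
  · exact fun h => .inr ⟨m, h, by omega⟩

theorem HasApprox.join {n : ℕ} {A B : Set ℕ} (hA : HasApprox n A) (hB : HasApprox n B) :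
    HasApprox n (join A B) := by
  obtain ⟨h, r, H, hlim⟩ := hA
  obtain ⟨h', r', H', hlim'⟩ := hB
  have hd : Computable fun p : ℕ × ℕ => p.1.div2 := Computable.nat_div2.comp Computable.fst
  have hb : Computable fun p : ℕ × ℕ => p.1.bodd := Computable.nat_bodd.comp Computable.fst
  refine ⟨fun x s => cond x.bodd (h' x.div2 s) (h x.div2 s),
    fun x s => cond x.bodd (r' x.div2 s) (r x.div2 s),
    ⟨Computable.cond hb (H'.computable_value.comp hd Computable.snd)
      (H.computable_value.comp hd Computable.snd),
    Computable.cond hb (H'.computable_rank.comp hd Computable.snd)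
      (H.computable_rank.comp hd Computable.snd), fun x s => ?_, fun x s => ?_⟩, fun x => ?_⟩
  · cases x.bodd
    · exact H.length_rank _ s
    · exact H'.length_rank _ s
  · cases x.bodd
    · exact H.step _ s
    · exact H'.step _ s
  · have hx := Nat.bodd_add_div2 x
    cases hb : x.bodd
    · rw [hb] at hx
      have : x ∈ _root_.join A B ↔ x.div2 ∈ A := by
        rw [← double_mem_join (A := A) (B := B)]
        simp at hx
        rw [show x.div2 + x.div2 = x by omega]
      simpa only [hb, cond_false, this] using hlim x.div2
    · rw [hb] at hx
      have : x ∈ _root_.join A B ↔ x.div2 ∈ B := by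
        rw [← double_succ_mem_join (A := A) (B := B)]
        simp at hx
        rw [show x.div2 + x.div2 + 1 = x by omega]
      simpa only [hb, cond_true, this] using hlim' x.div2

/-- Lexicographic comparison is compatible with coordinatewise (natural) sums. -/
theorem lexLT_sum {n N : ℕ} {f g : ℕ → List ℕ} (hf : ∀ w, (f w).length = n)
    (hg : ∀ w, (g w).length = n) (hle : ∀ w < N, f w = g w ∨ LexLT (f w) (g w))
    (hlt : ∃ w < N, LexLT (f w) (g w)) :
    LexLT ((List.range n).map fun i => ∑ w ∈ Finset.range N, (f w).getD i 0)
      ((List.range n).map fun i => ∑ w ∈ Finset.range N, (g w).getD i 0) := by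
  have hex : ∃ i, ∃ w < N, (f w).getD i 0 ≠ (g w).getD i 0 := by
    obtain ⟨w, hw, h⟩ := hlt
    obtain ⟨i, -, -, h⟩ := (lexLT_iff_getD (hf w) (hg w)).1 h
    exact ⟨i, w, hw, h.ne⟩
  have hmin : ∀ j < Nat.find hex, ∀ w < N, (f w).getD j 0 = (g w).getD j 0 := by
    intro j hj w hw
    by_contra hne
    exact Nat.find_min hex hj ⟨w, hw, hne⟩
  obtain ⟨w₀, hw₀, hne⟩ := Nat.find_spec hex
  set i := Nat.find hex
  have hle' : ∀ w < N, (f w).getD i 0 ≤ (g w).getD i 0 := by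
    intro w hw
    rcases hle w hw with h | h
    · rw [h]
    · obtain ⟨k, -, h1, h2⟩ := (lexLT_iff_getD (hf w) (hg w)).1 h
      rcases lt_trichotomy i k with hik | hik | hik
      · exact (h1 i hik).le
      · exact hik ▸ h2.le
      · exact absurd (hmin k hik w hw) h2.ne
  have hin : i < n := by
    by_contra hin
    refine hne ?_
    rw [List.getD_eq_default _ _ (by rw [hf]; omega), List.getD_eq_default _ _ (by rw [hg]; omega)]
  have hget : ∀ (F : ℕ → ℕ) k, k < n → ((List.range n).map F).getD k 0 = F k := by
    intro F k hk
    simp [List.getD, hk]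
  refine (lexLT_iff_getD (n := n) (by simp) (by simp)).2 ⟨i, hin, fun j hj => ?_, ?_⟩
  · rw [hget _ _ (by omega), hget _ _ (by omega)]
    exact Finset.sum_congr rfl fun w hw => hmin j hj w (Finset.mem_range.1 hw)
  · rw [hget _ _ hin, hget _ _ hin]
    exact Finset.sum_lt_sum (fun w hw => hle' w (Finset.mem_range.1 hw))
      ⟨w₀, Finset.mem_range.2 hw₀, (hle' w₀ hw₀).lt_of_ne hne⟩

theorem HasApprox.of_ttRed {n : ℕ} {A X : Set ℕ} (hA : HasApprox n A) (hX : TTRed X A) :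
    HasApprox n X := by
  obtain ⟨h, r, H, hlim⟩ := hA
  obtain ⟨u, d, hu, hd, hX⟩ := hX
  refine ⟨fun x s => d x ((List.range (u x)).map fun w => h w s),
    fun x s => (List.range n).map fun i => ∑ w ∈ Finset.range (u x), (r w s).getD i 0,
    ⟨?_, ?_, fun x s => by simp, fun x s => ?_⟩, fun x => ?_⟩
  · exact hd.comp Computable.fst (computable_map_range (hu.comp Computable.fst)
      (H.computable_value.comp Computable.snd (Computable.snd.comp Computable.fst)).to₂)
  · refine computable_map_range (Computable.const n) (computable_sum_range
      (hu.comp (Computable.fst.comp Computable.fst)) ?_)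
    exact computable_listGetD 0 (H.computable_rank.comp Computable.snd
      (Computable.snd.comp (Computable.fst.comp Computable.fst)))
      (Computable.snd.comp Computable.fst)
  · by_cases hall : ∀ w < u x, r w (s + 1) = r w s ∧ h w (s + 1) = h w s
    · left
      constructor
      · refine List.map_congr_left fun i _ => Finset.sum_congr rfl fun w hw => ?_
        rw [(hall w (Finset.mem_range.1 hw)).1]
      · congr 1
        exact List.map_congr_left fun w hw => (hall w (List.mem_range.1 hw)).2
    · right
      push Not at hall
      obtain ⟨w, hw, hne⟩ := hall
      refine lexLT_sum (fun w => H.length_rank w _) (fun w => H.length_rank w _)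
        (fun w _ => (H.step w s).imp_left And.left) ⟨w, hw, ?_⟩
      rcases H.step w s with h1 | h1
      · exact absurd h1.2 (hne h1.1)
      · exact h1
  · choose s₀ hs₀ using hlim
    refine ⟨∑ w ∈ Finset.range (u x), s₀ w, fun s hs => ?_⟩
    rw [hX]
    have : (List.range (u x)).map (fun w => h w s) = initSegB A (u x) := by
      refine List.map_congr_left fun w hw => ?_
      rw [Bool.eq_iff_iff, decide_eq_true_iff]
      refine hs₀ w s (le_trans ?_ hs)
      exact Finset.single_le_sum (f := s₀) (fun _ _ => Nat.zero_le _)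
        (Finset.mem_range.2 (List.mem_range.1 hw))
    simp only [this]

theorem pair_le_pair {a a' b b' : ℕ} (h : a ≤ a') (h' : b ≤ b') :
    Nat.pair a b ≤ Nat.pair a' b' :=
  (StrictMono.monotone (fun _ _ => Nat.pair_lt_pair_left b) h).trans
    (StrictMono.monotone (fun _ _ => Nat.pair_lt_pair_right a') h')

theorem encode_bits_le (l : List Bool) :
    Encodable.encode l ≤ Encodable.encode (List.replicate l.length true) := by
  induction l with
  | nil => simp
  | cons b l ih =>
    rw [List.length_cons, List.replicate_succ, Encodable.encode_list_cons,
      Encodable.encode_list_cons]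
    refine Nat.succ_le_succ (pair_le_pair ?_ ih)
    cases b <;> simp

/-- Feeding an initial segment of one approximable set to another one. -/
theorem HasApprox.of_initSegB {n : ℕ} {A Z : Set ℕ} (hA : HasApprox n A) (hZ : HasApprox n Z)
    {u : ℕ → ℕ} (hu : Computable u) :
    HasApprox n {x | Nat.pair x (Encodable.encode (initSegB A (u x))) ∈ Z} := by
  refine (hA.join hZ).of_ttRed ?_
  set q : ℕ → List Bool → ℕ := fun x l =>
    Nat.pair x (Encodable.encode ((List.range (u x)).map fun i => l.getD (i + i) false))
  have hq : Computable₂ q := by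
    refine computable_natPair Computable.fst (Computable.encode.comp
      (computable_map_range (hu.comp Computable.fst) ?_))
    exact computable_listGetD false (Computable.snd.comp Computable.fst)
      (computable_add Computable.snd Computable.snd)
  set v : ℕ → ℕ := fun x =>
    Nat.pair x (Encodable.encode ((List.range (u x)).map fun _ => true))
  have hv : Computable v := computable_natPair Computable.id (Computable.encode.comp
    (computable_map_range hu (Computable.const true)))
  refine ⟨fun x => u x + u x + (v x + v x) + 2,
    fun x l => l.getD (q x l + q x l + 1) false,
    computable_add (computable_add (computable_add hu hu) (computable_add hv hv))
      (Computable.const 2),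
    computable_listGetD false Computable.snd
      (computable_add (computable_add hq hq) (Computable.const 1)), fun x => ?_⟩
  set b := initSegB (_root_.join A Z) (u x + u x + (v x + v x) + 2)
  have h1 : q x b = Nat.pair x (Encodable.encode (initSegB A (u x))) := by
    have : (List.range (u x)).map (fun i => b.getD (i + i) false) = initSegB A (u x) := by
      refine List.map_congr_left fun i hi => ?_
      rw [List.mem_range] at hi
      rw [Bool.eq_iff_iff, decide_eq_true_iff, initSegB_getD_eq_true (by omega), double_mem_join]
    simp only [q, this]
  have h2 : q x b ≤ v x := by
    rw [h1]
    refine pair_le_pair le_rfl ((encode_bits_le _).trans (le_of_eq ?_))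
    simp [initSegB]
  rw [initSegB_getD_eq_true (by omega), double_succ_mem_join, h1, Set.mem_ofPred_eq]

theorem hasApprox_one_of_exists {p : ℕ → ℕ → Bool} (hp : Computable₂ p) :
    HasApprox 1 {x | ∃ t, p x t = true} := by
  refine OmegaCE.hasApprox ⟨fun m => bif Nat.beq (Denumerable.ofNat (List ℕ) m.unpair.2).headI 0
    then (Nat.rfind fun t => Part.some (p m.unpair.1 t)).map (fun _ => 1) else Part.some 0,
    ?_, ?_, fun x => ?_⟩
  · refine Partrec.cond (computable_decide_eq (computable_headI ((Computable.ofNat _).comp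
      (computable_unpair_snd Computable.id))) (Computable.const 0)) ?_ (Computable.const 0)
    exact Partrec.map (partrec_rfind_some (hp.comp (computable_unpair_fst Computable.fst)
      Computable.snd)) (Computable.const 1)
  · intro m y hy
    cases hc : Nat.beq (Denumerable.ofNat (List ℕ) m.unpair.2).headI 0 <;>
      simp only [hc, cond_true, cond_false, Part.mem_some_iff, Part.mem_map_iff] at hy
    · omega
    · obtain ⟨-, -, rfl⟩ := hy
      exact le_rfl
  · by_cases hx : ∃ t, p x t = true
    · refine ⟨[0], rfl, fun l' hl' hlt => ?_, ?_⟩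
      · obtain ⟨a, rfl⟩ := List.length_eq_one_iff.1 hl'
        have := lexLT_cons_cons.1 hlt
        simp at this
      · obtain ⟨t, ht⟩ := exists_mem_rfind_some hx
        simp only [Nat.unpair_pair, Denumerable.ofNat_encode]
        exact Part.mem_map_iff _ |>.2 ⟨t, ht, (chi_eq_one_iff.2 hx).symm⟩
    · refine ⟨[1], rfl, fun l' hl' hlt => ?_, ?_⟩
      · obtain ⟨a, rfl⟩ := List.length_eq_one_iff.1 hl'
        have := lexLT_cons_cons.1 hlt
        obtain rfl : a = 0 := by simpa using this
        simp only [Nat.unpair_pair, Denumerable.ofNat_encode]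
        intro hdom
        obtain ⟨y, hy⟩ := Part.dom_iff_mem.1 hdom
        obtain ⟨t, ht, -⟩ := (Part.mem_map_iff _).1 hy
        exact hx ⟨t, (mem_rfind_some.1 ht).1⟩
      · simp only [Nat.unpair_pair, Denumerable.ofNat_encode]
        exact Part.mem_some_iff.2 (if_neg hx)

/-- The first convergent value among a computable sequence of computations is `ω²`-c.e. -/
theorem hasApprox_two_of_least {c : Code} {a : ℕ → ℕ → ℕ} (ha : Computable₂ a) :
    HasApprox 2 {y | ∃ k, (∀ j < k, ¬ (c.eval (a y j)).Dom) ∧ 1 ∈ c.eval (a y k)} := by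
  refine OmegaCE.hasApprox ⟨fun m => bif Nat.beq (Denumerable.ofNat (List ℕ) m.unpair.2).headI 0
    then (c.eval (a m.unpair.1 (Denumerable.ofNat (List ℕ) m.unpair.2).tail.headI)).map
      (fun v => (Nat.beq v 1).toNat) else Part.some 0, ?_, ?_, fun x => ?_⟩
  · have hl : Computable fun m : ℕ => Denumerable.ofNat (List ℕ) m.unpair.2 :=
      (Computable.ofNat _).comp (computable_unpair_snd Computable.id)
    refine Partrec.cond (computable_decide_eq (computable_headI hl) (Computable.const 0)) ?_
      (Computable.const 0)
    refine Partrec.map ((Partrec.nat_iff.2 (Code.exists_code.2 ⟨c, rfl⟩)).comp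
      (ha.comp (computable_unpair_fst Computable.id) (computable_headI (computable_tail hl)))) ?_
    exact (Primrec.dom_bool Bool.toNat).to_comp.comp
      (computable_decide_eq Computable.snd (Computable.const 1))
  · intro m y hy
    cases hc : Nat.beq (Denumerable.ofNat (List ℕ) m.unpair.2).headI 0 <;>
      simp only [hc, cond_true, cond_false, Part.mem_some_iff, Part.mem_map_iff] at hy
    · omega
    · obtain ⟨v, -, rfl⟩ := hy
      exact Bool.toNat_le _
  · by_cases hx : ∃ k, (c.eval (a x k)).Dom
    · have hmin := fun j (hj : j < Nat.find hx) => Nat.find_min hx hj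
      obtain ⟨v, hv⟩ := Part.dom_iff_mem.1 (Nat.find_spec hx)
      set k := Nat.find hx
      refine ⟨[0, k], rfl, fun l' hl' hlt => ?_, ?_⟩
      · obtain ⟨b, j, rfl⟩ := List.length_eq_two.1 hl'
        obtain ⟨rfl, hj⟩ : b = 0 ∧ j < k := by
          simpa [lexLT_cons_cons, lexLT_irrefl] using (lexLT_cons_cons.1 hlt)
        simpa using hmin j hj
      · simp only [Nat.unpair_pair, Denumerable.ofNat_encode]
        refine (Part.mem_map_iff _).2 ⟨v, hv, (chi_eq_toNat ?_).symm⟩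
        rw [Nat.beq_eq]
        constructor
        · rintro rfl
          exact ⟨k, hmin, hv⟩
        · rintro ⟨k', hk', h1⟩
          obtain rfl : k' = k := by
            rcases lt_trichotomy k' k with h | h | h
            · exact absurd (Part.dom_iff_mem.2 ⟨1, h1⟩) (hmin _ h)
            · exact h
            · exact absurd (Part.dom_iff_mem.2 ⟨v, hv⟩) (hk' _ h)
          exact Part.mem_unique hv h1
    · refine ⟨[1, 0], rfl, fun l' hl' hlt => ?_, ?_⟩
      · obtain ⟨b, j, rfl⟩ := List.length_eq_two.1 hl'
        obtain rfl : b = 0 := by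
          simpa [lexLT_cons_cons, lexLT_irrefl] using (lexLT_cons_cons.1 hlt)
        simpa using not_exists.1 hx j
      · simp only [Nat.unpair_pair, Denumerable.ofNat_encode]
        refine Part.mem_some_iff.2 (if_neg ?_)
        rintro ⟨k, -, h1⟩
        exact hx ⟨k, Part.dom_iff_mem.2 ⟨1, h1⟩⟩

end Approximation

section Jump

theorem mem_Phi {e : ℕ} {A : Set ℕ} {x y : ℕ} :
    y ∈ Phi e A x ↔ ∃ k, (∀ j < k, ¬ (phi e (Nat.pair (Encodable.encode (initSeg A j)) x)).Dom) ∧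
      y ∈ phi e (Nat.pair (Encodable.encode (initSeg A k)) x) := by
  constructor
  · rintro ⟨h, rfl⟩
    exact ⟨Nat.find h, fun j hj => Nat.find_min h hj, Part.get_mem _⟩
  · rintro ⟨k, hk, hy⟩
    have h : ∃ k, (phi e (Nat.pair (Encodable.encode (initSeg A k)) x)).Dom :=
      ⟨k, Part.dom_iff_mem.2 ⟨y, hy⟩⟩
    have hfind : Nat.find h = k := (Nat.find_eq_iff h).2 ⟨Part.dom_iff_mem.2 ⟨y, hy⟩, hk⟩
    refine ⟨h, ?_⟩
    change (phi e (Nat.pair (Encodable.encode (initSeg A (Nat.find h))) x)).get _ = y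
    refine Part.get_eq_of_mem ?_ _
    rwa [hfind]

theorem computable_of_phi_dom {j : ℕ} (h : ∀ x, (phi j x).Dom) :
    Computable fun x => (phi j x).get (h x) := by
  have : Partrec (phi j) := Partrec.nat_iff.2 (Code.exists_code.2 ⟨_, rfl⟩)
  exact this.of_eq fun x => (Part.some_get (h x)).symm

theorem initSeg_restrictTo_of_le {A : Set ℕ} {v m k : ℕ} (hv : v ≤ m) :
    initSeg (restrictTo A v) k = (List.range k).map fun i =>
      ((initSegB A (m + 1)).getD i false && Nat.blt i (v + 1)).toNat := by
  refine List.map_congr_left fun i _ => chi_eq_toNat ?_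
  rw [Bool.and_eq_true, Nat.blt_eq]
  constructor
  · rintro ⟨h1, h2⟩
    exact ⟨(initSegB_getD_eq_true (by omega)).1 h1, by omega⟩
  · rintro ⟨h1, h2⟩
    exact ⟨(initSegB_getD_eq_true (by omega)).2 h1, by omega⟩

theorem initSeg_restrictTo {A : Set ℕ} {m k : ℕ} :
    initSeg (restrictTo A m) k = (List.range k).map fun i =>
      ((initSegB A (m + 1)).getD i false).toNat := by
  rw [initSeg_restrictTo_of_le le_rfl]
  refine List.map_congr_left fun i _ => ?_
  cases hb : Nat.blt i (m + 1)
  · have : ¬ i < m + 1 := by rw [← Nat.blt_eq, hb]; simp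
    rw [List.getD_eq_default _ _ (by simp [initSegB]; omega), Bool.and_false]
  · rw [Bool.and_true]

/-- The bit string coded by a natural number. -/
def decodeBits (n : ℕ) : List Bool := (Encodable.decode (α := List Bool) n).getD []

theorem decodeBits_encode (l : List Bool) : decodeBits (Encodable.encode l) = l := by
  simp [decodeBits]

theorem computable_decodeBits {α : Type*} [Primcodable α] {f : α → ℕ} (hf : Computable f) :
    Computable fun a => decodeBits (f a) :=
  Computable.option_getD (Computable.decode.comp hf) (Computable.const [])

theorem computable_toNat {α : Type*} [Primcodable α] {f : α → Bool} (hf : Computable f) :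
    Computable fun a => (f a).toNat :=
  (Primrec.dom_bool Bool.toNat).to_comp.comp hf

theorem HasApprox.of_bTReducible {n : ℕ} (hn : 2 ≤ n) {A X : Set ℕ} (hA : HasApprox n A)
    (hX : bTReducible X A) : HasApprox n X := by
  obtain ⟨e, j, h, hX⟩ := hX
  set a : ℕ → ℕ → ℕ := fun y k => Nat.pair (Encodable.encode ((List.range k).map fun i =>
    ((decodeBits y.unpair.2).getD i false).toNat)) y.unpair.1
  have ha : Computable₂ a := by
    refine computable_natPair (Computable.encode.comp (computable_map_range Computable.snd ?_))
      (computable_unpair_fst Computable.fst)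
    exact computable_toNat (computable_listGetD false (computable_decodeBits
      (computable_unpair_snd (Computable.fst.comp Computable.fst))) Computable.snd)
  have hZ := (hasApprox_two_of_least (c := Denumerable.ofNat Code e) ha).mono hn
  have hT := hA.of_initSegB hZ (u := fun x => (phi j x).get (h x) + 1)
    (computable_add (computable_of_phi_dom h) (Computable.const 1))
  convert hT using 1
  ext x
  have h1 : x ∈ X ↔ 1 ∈ Phi e (restrictTo A ((phi j x).get (h x))) x := by
    rw [hX x, Part.mem_some_iff, eq_comm, chi_eq_one_iff]
  rw [h1, mem_Phi]
  simp only [Set.mem_ofPred_eq, a, Nat.unpair_pair, decodeBits_encode, initSeg_restrictTo]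
  rfl

theorem exists_stage_evaln (c : Code) (x : ℕ) :
    ∃ s₀, ∀ s ≥ s₀, ∀ v, v ∈ Code.evaln s c x ↔ v ∈ c.eval x := by
  by_cases h : (c.eval x).Dom
  · obtain ⟨v, hv⟩ := Part.dom_iff_mem.1 h
    obtain ⟨s₀, hs₀⟩ := Code.evaln_complete.1 hv
    refine ⟨s₀, fun s hs w => ⟨Code.evaln_sound, fun hw => ?_⟩⟩
    obtain rfl := Part.mem_unique hv hw
    exact Code.evaln_mono hs hs₀
  · exact ⟨0, fun s _ v => ⟨Code.evaln_sound, fun hv => absurd (Part.dom_iff_mem.2 ⟨v, hv⟩) h⟩⟩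

/-- Bounded search for a witness that `x` enters the bounded jump, with oracle string `σ`;
the input is `⟨⟨x, m⟩, σ⟩` and the witness is `⟨i, v, k, w⟩`. -/
def jumpWitness (z t : ℕ) : Bool :=
  let x := z.unpair.1.unpair.1
  let i := t.unpair.1
  let v := t.unpair.2.unpair.1
  let k := t.unpair.2.unpair.2.unpair.1
  let w := t.unpair.2.unpair.2.unpair.2
  Nat.blt i (x + 1) && (Nat.beq (Encodable.encode (Code.evaln w (Denumerable.ofNat Code i) x))
    (v + 1) && (Code.evaln w (Denumerable.ofNat Code x) (Nat.pair (Encodable.encode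
      ((List.range k).map fun j => ((decodeBits z.unpair.2).getD j false &&
        Nat.blt j (v + 1)).toNat)) x)).isSome)

theorem computable_jumpWitness : Computable₂ jumpWitness := by
  have hx : Computable fun q : ℕ × ℕ => q.1.unpair.1.unpair.1 :=
    computable_unpair_fst (computable_unpair_fst Computable.fst)
  have hi : Computable fun q : ℕ × ℕ => q.2.unpair.1 := computable_unpair_fst Computable.snd
  have ht := computable_unpair_snd (Computable.snd (α := ℕ) (β := ℕ))
  have hv := computable_unpair_fst ht
  have hk := computable_unpair_fst (computable_unpair_snd ht)
  have hw := computable_unpair_snd (computable_unpair_snd ht)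
  have hσ := computable_decodeBits (computable_unpair_snd (Computable.fst (α := ℕ) (β := ℕ)))
  refine computable_and (computable_decide_lt hi (computable_add hx (Computable.const 1)))
    (computable_and (computable_decide_eq (Computable.encode.comp
      (computable_evaln hw ((Computable.ofNat Code).comp hi) hx))
      (computable_add hv (Computable.const 1)))
    (computable_isSome (computable_evaln hw ((Computable.ofNat Code).comp hx)
      (computable_natPair (Computable.encode.comp (computable_map_range hk ?_)) hx))))
  exact computable_toNat (computable_and (computable_listGetD false (hσ.comp Computable.fst)
    Computable.snd) (computable_decide_lt Computable.snd
      (computable_add (hv.comp Computable.fst) (Computable.const 1))))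

theorem encode_option_eq {o : Option ℕ} {v : ℕ} : Encodable.encode o = v + 1 ↔ v ∈ o := by
  cases o <;> simp

theorem exists_jumpWitness_iff {x m : ℕ} {σ : List Bool} :
    (∃ t, jumpWitness (Nat.pair (Nat.pair x m) (Encodable.encode σ)) t = true) ↔
      ∃ i ≤ x, ∃ v ∈ phi i x, ∃ k, (phi x (Nat.pair (Encodable.encode ((List.range k).map fun j =>
        (σ.getD j false && Nat.blt j (v + 1)).toNat)) x)).Dom := by
  constructor
  · rintro ⟨t, ht⟩
    simp only [jumpWitness, Nat.unpair_pair, decodeBits_encode, Bool.and_eq_true, Nat.blt_eq,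
      Nat.beq_eq, encode_option_eq, Option.isSome_iff_exists] at ht
    obtain ⟨hi, hv, w, hw⟩ := ht
    exact ⟨_, Nat.lt_succ_iff.1 hi, _, Code.evaln_sound hv, _,
      Part.dom_iff_mem.2 ⟨w, Code.evaln_sound hw⟩⟩
  · rintro ⟨i, hi, v, hv, k, hk⟩
    obtain ⟨y, hy⟩ := Part.dom_iff_mem.1 hk
    obtain ⟨s, hs⟩ := Code.evaln_complete.1 hv
    obtain ⟨s', hs'⟩ := Code.evaln_complete.1 hy
    refine ⟨Nat.pair i (Nat.pair v (Nat.pair k (s + s'))), ?_⟩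
    simp only [jumpWitness, Nat.unpair_pair, decodeBits_encode, Bool.and_eq_true, Nat.blt_eq,
      Nat.beq_eq, encode_option_eq, Option.isSome_iff_exists]
    exact ⟨Nat.lt_succ_iff.2 hi, Code.evaln_mono (Nat.le_add_right _ _) hs, y,
      Code.evaln_mono (Nat.le_add_left _ _) hs'⟩

theorem mem_bJump_iff {A : Set ℕ} {x : ℕ} : x ∈ bJump A ↔ ∃ i ≤ x, ∃ v ∈ phi i x, ∃ k,
    (phi x (Nat.pair (Encodable.encode (initSeg (restrictTo A v) k)) x)).Dom := by
  constructor
  · rintro ⟨i, hi, h, k, hk⟩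
    exact ⟨i, hi, _, Part.get_mem h, k, hk⟩
  · rintro ⟨i, hi, v, ⟨h, rfl⟩, k, hk⟩
    exact ⟨i, hi, h, k, hk⟩

theorem mem_bJump_iff_jumpWitness {A : Set ℕ} {x m : ℕ} (hm : ∀ i ≤ x, ∀ v ∈ phi i x, v ≤ m) :
    x ∈ bJump A ↔ ∃ t, jumpWitness (Nat.pair (Nat.pair x m)
      (Encodable.encode (initSegB A (m + 1)))) t = true := by
  rw [mem_bJump_iff, exists_jumpWitness_iff]
  refine exists_congr fun i => and_congr_right fun hi => exists_congr fun v =>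
    and_congr_right fun hv => exists_congr fun k => ?_
  rw [initSeg_restrictTo_of_le (hm i hi v hv)]

theorem HasApprox.bJump {n : ℕ} (hn : 1 ≤ n) {A : Set ℕ} (hA : HasApprox n A) :
    HasApprox (n + 1) (bJump A) := by
  obtain ⟨h, r, H, hlim⟩ := hA.of_initSegB ((hasApprox_one_of_exists computable_jumpWitness).mono hn)
    (u := fun y => y.unpair.2 + 1)
    (computable_add (computable_unpair_snd Computable.id) (Computable.const 1))
  set ev : ℕ → ℕ → ℕ → Option ℕ := fun x s i => Code.evaln s (Denumerable.ofNat Code i) x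
  have hev : Computable fun q : (ℕ × ℕ) × ℕ => ev q.1.1 q.1.2 q.2 :=
    computable_evaln (Computable.snd.comp Computable.fst)
      ((Computable.ofNat Code).comp Computable.snd) (Computable.fst.comp Computable.fst)
  set m : ℕ → ℕ → ℕ := fun x s => ∑ i ∈ Finset.range (x + 1), (ev x s i).getD 0
  set k : ℕ → ℕ → ℕ := fun x s => ∑ i ∈ Finset.range (x + 1), (!(ev x s i).isSome).toNat
  have hx1 : Computable fun q : ℕ × ℕ => q.1 + 1 :=
    computable_add Computable.fst (Computable.const 1)
  have hm : Computable₂ m :=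
    computable_sum_range hx1 (Computable.option_getD hev (Computable.const 0))
  have hk : Computable₂ k :=
    computable_sum_range hx1 (computable_toNat (computable_not (computable_isSome hev)))
  have hy : Computable fun q : ℕ × ℕ => Nat.pair q.1 (m q.1 q.2) :=
    computable_natPair Computable.fst hm
  refine ⟨fun x s => h (Nat.pair x (m x s)) s, fun x s => k x s :: r (Nat.pair x (m x s)) s,
    ⟨H.computable_value.comp hy Computable.snd,
      Computable.list_cons.comp hk (H.computable_rank.comp hy Computable.snd),
      fun x s => by simp [H.length_rank], fun x s => ?_⟩, fun x => ?_⟩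
  · by_cases hall : ∀ i < x + 1, ev x (s + 1) i = ev x s i
    · have hm' : m x (s + 1) = m x s :=
        Finset.sum_congr rfl fun i hi => by rw [hall i (Finset.mem_range.1 hi)]
      have hk' : k x (s + 1) = k x s :=
        Finset.sum_congr rfl fun i hi => by rw [hall i (Finset.mem_range.1 hi)]
      rw [hm', hk']
      rcases H.step (Nat.pair x (m x s)) s with ⟨h1, h2⟩ | h1
      · exact .inl ⟨by rw [h1], h2⟩
      · exact .inr (List.Lex.cons h1)
    · right
      push Not at hall
      obtain ⟨i, hi, hne⟩ := hall
      have hmono : ∀ j v, v ∈ ev x s j → v ∈ ev x (s + 1) j := fun j v hv =>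
        Code.evaln_mono (Nat.le_succ s) hv
      refine List.Lex.rel (Finset.sum_lt_sum (fun j _ => ?_) ⟨i, Finset.mem_range.2 hi, ?_⟩)
      · cases hj : ev x s j with
        | none => exact Bool.toNat_le _
        | some v => rw [hmono j v hj]
      · cases hj : ev x s i with
        | none =>
          cases hj' : ev x (s + 1) i with
          | none => exact absurd (hj'.trans hj.symm) hne
          | some v => simp
        | some v => exact absurd ((hmono i v hj).trans hj.symm) hne
  · choose s₀ hs₀ using fun i => exists_stage_evaln (Denumerable.ofNat Code i) x
    set s₁ := ∑ i ∈ Finset.range (x + 1), s₀ i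
    have hle : ∀ i < x + 1, s₀ i ≤ s₁ := fun i hi =>
      Finset.single_le_sum (f := s₀) (fun _ _ => Nat.zero_le _) (Finset.mem_range.2 hi)
    have hconst : ∀ s ≥ s₁, m x s = m x s₁ := fun s hs =>
      Finset.sum_congr rfl fun i hi => by
        have := hle i (Finset.mem_range.1 hi)
        congr 1
        exact Option.ext fun v => (hs₀ i s (this.trans hs) v).trans (hs₀ i s₁ this v).symm
    obtain ⟨s₂, hs₂⟩ := hlim (Nat.pair x (m x s₁))
    refine ⟨s₁ + s₂, fun s hs => ?_⟩
    beta_reduce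
    rw [hconst s (by omega), hs₂ s (by omega), mem_bJump_iff_jumpWitness (m := m x s₁)]
    · simp only [Set.mem_ofPred_eq, Nat.unpair_pair]
    · intro i hi v hv
      have h1 : ev x s₁ i = some v := (hs₀ i s₁ (hle i (by omega)) v).2 hv
      have h2 := Finset.single_le_sum (f := fun i => (ev x s₁ i).getD 0)
        (fun _ _ => Nat.zero_le _) (Finset.mem_range.2 (show i < x + 1 by omega))
      simpa [h1] using h2

theorem hasApprox_bIter : ∀ {n : ℕ}, 1 ≤ n → HasApprox n (bIter n) := by
  intro n hn
  induction n, hn using Nat.le_induction with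
  | base =>
    have h := (hasApprox_one_of_exists computable_jumpWitness).preimage
      (f := fun x => Nat.pair (Nat.pair x 0) (Encodable.encode ([] : List Bool)))
      (computable_natPair (computable_natPair Computable.id (Computable.const 0))
        (Computable.const _))
    convert h using 1
    ext x
    change x ∈ _root_.bJump ∅ ↔ ∃ t, _
    rw [mem_bJump_iff, exists_jumpWitness_iff]
    refine exists_congr fun i => and_congr_right fun hi => exists_congr fun v =>
      and_congr_right fun hv => exists_congr fun k => ?_
    have : initSeg (restrictTo ∅ v) k = (List.range k).map fun j =>
        (([] : List Bool).getD j false && Nat.blt j (v + 1)).toNat := by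
      refine List.map_congr_left fun j _ => ?_
      simp [chi, restrictTo]
    rw [this]
  | succ n hn ih => exact ih.bJump hn

end Jump

section Reductions

theorem beq_iff {a b : ℕ} : Nat.beq a b = true ↔ a = b := iff_of_eq Nat.beq_eq

theorem le_encode_const (n : ℕ) : n ≤ Encodable.encode (Code.const n) := by
  induction n with
  | zero => exact Nat.zero_le _
  | succ n ih => exact ih.trans_lt (Code.encode_lt_comp Code.succ (Code.const n)).2

theorem le_encode_curry (c : Code) (n : ℕ) : n ≤ Encodable.encode (c.curry n) :=
  ((le_encode_const n).trans_lt ((Code.encode_lt_pair _ _).1.trans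
    (Code.encode_lt_comp c ((Code.const n).pair Code.id)).2)).le

theorem computable_encode_curry {α : Type*} [Primcodable α] (c : Code) {f : α → ℕ}
    (hf : Computable f) : Computable fun a => Encodable.encode (c.curry (f a)) :=
  Computable.encode.comp (Code.primrec₂_curry.to_comp.comp (Computable.const c) hf)

theorem encode_curry_injective (c : Code) :
    Function.Injective fun n => Encodable.encode (c.curry n) := fun _ _ h =>
  (Code.curry_inj (Encodable.encode_injective h)).2

theorem phi_encode_curry (c : Code) (n x : ℕ) :
    phi (Encodable.encode (c.curry n)) x = c.eval (Nat.pair n x) := by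
  rw [phi, Denumerable.ofNat_encode, Code.eval_curry]

theorem exists_code_of_partrec {f : ℕ →. ℕ} (hf : Partrec f) : ∃ c : Code, c.eval = f :=
  Code.exists_code.1 (Partrec.nat_iff.1 hf)

theorem oneReducible_bJump_of_exists {p : ℕ → ℕ → Bool} (hp : Computable₂ p) (B : Set ℕ) :
    oneReducible {x | ∃ t, p x t = true} (bJump B) := by
  obtain ⟨c, hc⟩ := exists_code_of_partrec (f := fun m => Nat.rfind fun t =>
    Part.some (p m.unpair.1 t)) (partrec_rfind_some
      (hp.comp (computable_unpair_fst Computable.fst) Computable.snd))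
  have heval : ∀ x y, c.eval (Nat.pair x y) = Nat.rfind fun t => Part.some (p x t) := by
    intro x y
    simp only [hc, Nat.unpair_pair]
  refine ⟨_, computable_encode_curry c Computable.id, encode_curry_injective c, fun x => ?_⟩
  rw [mem_bJump_iff]
  simp only [phi_encode_curry, heval, id]
  constructor
  · intro hx
    obtain ⟨t, ht⟩ := exists_mem_rfind_some hx
    exact ⟨_, le_rfl, t, by rwa [phi_encode_curry, heval], 0, Part.dom_iff_mem.2 ⟨t, ht⟩⟩
  · rintro ⟨-, -, -, -, -, h⟩
    obtain ⟨t, ht⟩ := Part.dom_iff_mem.1 h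
    exact ⟨t, (mem_rfind_some.1 ht).1⟩

theorem TTRed.of_oneReducible {X A : Set ℕ} (h : oneReducible X A) : TTRed X A := by
  obtain ⟨f, hf, -, hX⟩ := h
  refine ⟨fun x => f x + 1, fun x σ => σ.getD (f x) false,
    computable_add hf (Computable.const 1),
    computable_listGetD false Computable.snd (hf.comp Computable.fst), fun x => ?_⟩
  rw [hX, initSegB_getD_eq_true (Nat.lt_succ_self _)]

theorem oneReducible.bTReducible {X Y : Set ℕ} (h : oneReducible X Y) : bTReducible X Y := by
  obtain ⟨f, hf, -, hX⟩ := h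
  obtain ⟨j, hj⟩ := exists_code_of_partrec hf
  obtain ⟨e, he⟩ := exists_code_of_partrec (f := fun m =>
      (((Denumerable.ofNat (List ℕ) m.unpair.1)[f m.unpair.2]? : Option ℕ) : Part ℕ))
    (Computable.ofOption (Primrec.list_getElem?.to_comp.comp
      ((Computable.ofNat _).comp (computable_unpair_fst Computable.id))
      (hf.comp (computable_unpair_snd Computable.id))))
  have hphi : ∀ x, phi (Encodable.encode j) x = Part.some (f x) := by
    intro x
    rw [phi, Denumerable.ofNat_encode, hj]
    rfl
  have heval : ∀ (l : List ℕ) (x : ℕ), phi (Encodable.encode e) (Nat.pair (Encodable.encode l) x) =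
      ((l[f x]? : Option ℕ) : Part ℕ) := by
    intro l x
    rw [phi, Denumerable.ofNat_encode, he]
    simp only [Nat.unpair_pair, Denumerable.ofNat_encode]
  refine ⟨Encodable.encode e, Encodable.encode j, fun x => by rw [hphi]; trivial, fun x => ?_⟩
  simp only [hphi, Part.get_some]
  refine Part.eq_some_iff.2 (mem_Phi.2 ⟨f x + 1, fun i hi => ?_, ?_⟩)
  · rw [heval, List.getElem?_eq_none (by simp [initSeg]; omega)]
    exact id
  · rw [heval]
    have : (initSeg (restrictTo Y (f x)) (f x + 1))[f x]? = some (chi X x) := by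
      simp [initSeg, chi, restrictTo, hX]
    rw [this]
    exact Part.mem_some _

/-- An element of every bounded jump which is at least `m`. -/
def sentinel (m : ℕ) : ℕ := Encodable.encode (Code.zero.curry m)

theorem le_sentinel (m : ℕ) : m ≤ sentinel m := le_encode_curry _ _

theorem computable_sentinel : Computable sentinel :=
  computable_encode_curry _ Computable.id

theorem sentinel_mem_bJump (m : ℕ) (B : Set ℕ) : sentinel m ∈ bJump B := by
  have hz : ∀ x, phi (sentinel m) x = Part.some 0 := fun x => phi_encode_curry _ _ _
  refine mem_bJump_iff.2 ⟨sentinel m, le_rfl, 0, ?_, 0, ?_⟩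
  · rw [hz]
    exact Part.mem_some _
  · rw [hz]
    trivial

theorem RankedProcess.step_head {n : ℕ} {h : ℕ → ℕ → Bool} {r : ℕ → ℕ → List ℕ}
    (H : RankedProcess (n + 1) h r) (x : ℕ) {s t : ℕ} (hst : s ≤ t) :
    (r x t).headI < (r x s).headI ∨ (r x t).headI = (r x s).headI ∧
      ((r x t).tail = (r x s).tail ∧ h x t = h x s ∨ LexLT (r x t).tail (r x s).tail) := by
  rcases H.step_le x hst with ⟨h1, h2⟩ | h1
  · rw [h1]
    exact .inr ⟨rfl, .inl ⟨rfl, h2⟩⟩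
  · obtain ⟨a, l, ha⟩ := List.exists_cons_of_length_eq_add_one (H.length_rank x t)
    obtain ⟨b, l', hb⟩ := List.exists_cons_of_length_eq_add_one (H.length_rank x s)
    rw [ha, hb] at h1 ⊢
    exact (lexLT_cons_cons.1 h1).imp_right fun h => ⟨h.1, .inr h.2⟩

theorem RankedProcess.head_antitone {n : ℕ} {h : ℕ → ℕ → Bool} {r : ℕ → ℕ → List ℕ}
    (H : RankedProcess (n + 1) h r) (x : ℕ) : Antitone fun s => (r x s).headI := fun s t hst => by
  rcases H.step_head x hst with h1 | h1
  · exact h1.le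
  · exact h1.1.le

theorem RankedProcess.exists_final_head {n : ℕ} {h : ℕ → ℕ → Bool} {r : ℕ → ℕ → List ℕ}
    (H : RankedProcess (n + 1) h r) (x : ℕ) :
    ∃ c ≤ (r x 0).headI, (∃ s, (r x s).headI = c) ∧
      ∀ s, c ≤ (r x s).headI ∧ ((r x s).headI = c → ∀ t ≥ s, (r x t).headI = c) := by
  have hex : ∃ c s, (r x s).headI = c := ⟨_, 0, rfl⟩
  have hmin : ∀ s, Nat.find hex ≤ (r x s).headI := fun s => Nat.find_min' hex ⟨s, rfl⟩
  refine ⟨Nat.find hex, hmin 0, Nat.find_spec hex, fun s => ⟨hmin s, fun hs t ht => ?_⟩⟩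
  exact le_antisymm ((H.head_antitone x ht).trans hs.le) (hmin t)

theorem ttRed_bJump_of_hasApprox_one {X : Set ℕ} (hX : HasApprox 1 X) (B : Set ℕ) :
    TTRed X (bJump B) := by
  obtain ⟨h, r, H, hlim⟩ := hX
  have ha : Computable₂ fun (y s : ℕ) => (r y.unpair.1 s).headI :=
    computable_headI (H.computable_rank.comp (computable_unpair_fst Computable.fst) Computable.snd)
  have hh : Computable₂ fun (y s : ℕ) => h y.unpair.1 s :=
    H.computable_value.comp (computable_unpair_fst Computable.fst) Computable.snd
  have hy := computable_unpair_snd (Computable.fst (α := ℕ) (β := ℕ))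
  obtain ⟨f, hf, -, hf'⟩ := oneReducible_bJump_of_exists
    (p := fun y s => Nat.beq (r y.unpair.1 s).headI y.unpair.2 && h y.unpair.1 s)
    (computable_and (computable_decide_eq ha hy) hh) B
  obtain ⟨g, hg, -, hg'⟩ := oneReducible_bJump_of_exists
    (p := fun y s => Nat.blt (r y.unpair.1 s).headI y.unpair.2) (computable_decide_lt ha hy) B
  simp only [Set.mem_ofPred_eq, Bool.and_eq_true, Nat.beq_eq] at hf'
  simp only [Set.mem_ofPred_eq, Nat.blt_eq] at hg'
  have hk : Computable fun x => (r x 0).headI + 1 := computable_add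
    (computable_headI (H.computable_rank.comp Computable.id (Computable.const 0)))
    (Computable.const 1)
  refine ⟨fun x => ∑ k ∈ Finset.range ((r x 0).headI + 1), (f (Nat.pair x k) + g (Nat.pair x k)) + 1,
    fun x σ => Nat.blt 0 (∑ k ∈ Finset.range ((r x 0).headI + 1),
      (σ.getD (f (Nat.pair x k)) false && !σ.getD (g (Nat.pair x k)) false).toNat), ?_, ?_,
    fun x => ?_⟩
  · have hp := computable_natPair (Computable.fst (α := ℕ) (β := ℕ)) Computable.snd
    exact computable_add (computable_sum_range hk (computable_add (hf.comp hp) (hg.comp hp)))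
      (Computable.const 1)
  · have hp : Computable fun q : (ℕ × List Bool) × ℕ => Nat.pair q.1.1 q.2 :=
      computable_natPair (Computable.fst.comp Computable.fst) Computable.snd
    have hσ : Computable fun q : (ℕ × List Bool) × ℕ => q.1.2 := Computable.snd.comp Computable.fst
    exact computable_decide_lt (Computable.const 0) (computable_sum_range (hk.comp Computable.fst)
      (computable_toNat (computable_and (computable_listGetD false hσ (hf.comp hp))
        (computable_not (computable_listGetD false hσ (hg.comp hp))))))
  · set u := ∑ k ∈ Finset.range ((r x 0).headI + 1), (f (Nat.pair x k) + g (Nat.pair x k)) + 1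
      with hu
    have hlt : ∀ k ≤ (r x 0).headI, f (Nat.pair x k) < u ∧ g (Nat.pair x k) < u := by
      intro k hk
      have := Finset.single_le_sum (f := fun k => f (Nat.pair x k) + g (Nat.pair x k))
        (fun _ _ => Nat.zero_le _) (Finset.mem_range.2 (show k < (r x 0).headI + 1 by omega))
      omega
    have hd : Nat.blt 0 (∑ k ∈ Finset.range ((r x 0).headI + 1),
        ((initSegB (bJump B) u).getD (f (Nat.pair x k)) false &&
          !(initSegB (bJump B) u).getD (g (Nat.pair x k)) false).toNat) = true ↔
        ∃ k ≤ (r x 0).headI, (∃ s, (r x s).headI = k ∧ h x s = true) ∧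
          ¬ ∃ s, (r x s).headI < k := by
      rw [Nat.blt_eq, Finset.sum_pos_iff]
      refine exists_congr fun k => ?_
      rw [Finset.mem_range, Nat.lt_succ_iff]
      refine and_congr_right fun hk => ?_
      have h1 := hf' (Nat.pair x k)
      have h2 := hg' (Nat.pair x k)
      simp only [Nat.unpair_pair] at h1 h2
      rw [h1, h2, ← initSegB_getD_eq_true (hlt k hk).1, ← initSegB_getD_eq_true (hlt k hk).2]
      cases (initSegB (bJump B) u).getD (f (Nat.pair x k)) false <;>
        cases (initSegB (bJump B) u).getD (g (Nat.pair x k)) false <;> simp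
    rw [hd]
    have hstable : ∀ s k, (r x s).headI = k → (∀ t, k ≤ (r x t).headI) →
        (h x s = true ↔ x ∈ X) := by
      intro s k hs hmin
      obtain ⟨s₀, hs₀⟩ := hlim x
      rw [← hs₀ (s + s₀) (by omega)]
      rcases H.step_head x (Nat.le_add_right s s₀) with h1 | ⟨-, ⟨-, h1⟩ | h1⟩
      · exact absurd h1 (hs ▸ (hmin _).not_gt)
      · rw [h1]
      · rw [List.eq_nil_of_length_eq_zero (l := (r x s).tail) (by simp [H.length_rank])] at h1
        exact absurd h1 (List.not_lt_nil _)
    constructor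
    · intro hx
      obtain ⟨c, hc0, ⟨s, hs⟩, hc⟩ := H.exists_final_head x
      refine ⟨c, hc0, ⟨s, hs, (hstable s c hs fun t => (hc t).1).2 hx⟩, ?_⟩
      rintro ⟨t, ht⟩
      exact ht.not_ge (hc t).1
    · rintro ⟨k, -, ⟨s, hs, hv⟩, hk⟩
      exact (hstable s k hs fun t => not_lt.1 (not_exists.1 hk t)).1 hv

theorem lexLT_map_succ {l l' : List ℕ} (h : LexLT l l') :
    LexLT (l.map Nat.succ) (l'.map Nat.succ) := by
  induction h with
  | nil => exact List.Lex.nil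
  | cons _ ih => exact List.Lex.cons ih
  | rel h => exact List.Lex.rel (Nat.succ_lt_succ h)

theorem lexLT_replicate_zero_map_succ {n : ℕ} (hn : 1 ≤ n) {l : List ℕ} (hl : l.length = n) :
    LexLT (List.replicate n 0) (l.map Nat.succ) := by
  subst hl
  cases l with
  | nil => simp at hn
  | cons a l => exact List.Lex.rel (Nat.succ_pos a)

/-- The pairs `⟨x, s⟩` such that `x ∈ X` and the leading rank coefficient of `x` is final at
stage `s`. -/
def finalStages (r : ℕ → ℕ → List ℕ) (X : Set ℕ) : Set ℕ :=
  {y | (∀ t ≥ y.unpair.2, (r y.unpair.1 t).headI = (r y.unpair.1 y.unpair.2).headI) ∧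
    y.unpair.1 ∈ X}

theorem RankedProcess.hasApprox_finalStages {n : ℕ} (hn : 1 ≤ n) {h : ℕ → ℕ → Bool}
    {r : ℕ → ℕ → List ℕ} (H : RankedProcess (n + 1) h r) {X : Set ℕ}
    (hlim : ∀ x, ∃ s₀, ∀ s ≥ s₀, (h x s = true ↔ x ∈ X)) :
    HasApprox n (finalStages r X) := by
  set b : ℕ → ℕ → Bool := fun y t => Nat.beq (r y.unpair.1 (y.unpair.2 + t)).headI
    (r y.unpair.1 y.unpair.2).headI
  have hx : Computable fun q : ℕ × ℕ => q.1.unpair.1 := computable_unpair_fst Computable.fst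
  have hs : Computable fun q : ℕ × ℕ => q.1.unpair.2 := computable_unpair_snd Computable.fst
  have hst := computable_add hs Computable.snd
  have hbc : Computable₂ b := computable_decide_eq (computable_headI (H.computable_rank.comp hx hst))
    (computable_headI (H.computable_rank.comp hx hs))
  refine ⟨fun y t => bif b y t then h y.unpair.1 (y.unpair.2 + t) else false,
    fun y t => bif b y t then (r y.unpair.1 (y.unpair.2 + t)).tail.map Nat.succ
      else List.replicate n 0,
    ⟨Computable.cond hbc (H.computable_value.comp hx hst) (Computable.const _),
      Computable.cond hbc ?_ (Computable.const _), fun y t => ?_, fun y t => ?_⟩, fun y => ?_⟩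
  · exact (Primrec.list_map Primrec.id (Primrec.succ.comp Primrec.snd).to₂).to_comp.comp
      (computable_tail (H.computable_rank.comp hx hst))
  · cases b y t <;> simp [H.length_rank]
  · cases h1 : b y t <;> cases h2 : b y (t + 1) <;> simp only [cond_true, cond_false]
    · exact .inl ⟨trivial, trivial⟩
    · have h1 := mt beq_iff.2 (Bool.not_eq_true _ |>.mpr h1)
      have h2 := beq_iff.1 h2
      have h3 := H.head_antitone y.unpair.1 (Nat.le_add_right y.unpair.2 t)
      have h4 := H.head_antitone y.unpair.1 (Nat.le_succ (y.unpair.2 + t))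
      dsimp only at h3 h4
      rw [← add_assoc] at h2
      exact absurd (le_antisymm h3 (h2 ▸ h4)) h1
    · exact .inr (lexLT_replicate_zero_map_succ hn (by simp [H.length_rank]))
    · have h1 := beq_iff.1 h1
      have h2 := beq_iff.1 h2
      rcases H.step_head y.unpair.1 (Nat.le_succ (y.unpair.2 + t)) with h3 | ⟨-, ⟨h3, h4⟩ | h3⟩
      · rw [← add_assoc, ← h1] at h2
        exact absurd h2 h3.ne
      · exact .inl ⟨congrArg _ h3, h4⟩
      · exact .inr (lexLT_map_succ h3)
  · by_cases hfin : ∀ t ≥ y.unpair.2, (r y.unpair.1 t).headI = (r y.unpair.1 y.unpair.2).headI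
    · obtain ⟨s₀, hs₀⟩ := hlim y.unpair.1
      refine ⟨s₀, fun t ht => ?_⟩
      have h1 : b y t = true := beq_iff.2 (hfin _ (Nat.le_add_right _ _))
      simp only [h1, cond_true]
      rw [hs₀ _ (by omega)]
      exact ⟨fun h => ⟨hfin, h⟩, fun h => h.2⟩
    · refine (not_forall.1 hfin).elim fun t₀ ht₀ => ?_
      obtain ⟨ht₀, hne⟩ := Classical.not_imp.1 ht₀
      refine ⟨t₀, fun t ht => ?_⟩
      have h1 : b y t = false := by
        rw [← Bool.not_eq_true]
        intro h1
        have h2 : (r y.unpair.1 (y.unpair.2 + t)).headI = (r y.unpair.1 y.unpair.2).headI :=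
          beq_iff.1 h1
        have h3 := H.head_antitone y.unpair.1 (show t₀ ≤ y.unpair.2 + t by omega)
        have h4 := H.head_antitone y.unpair.1 ht₀
        dsimp only at h3 h4
        omega
      simp only [h1, cond_false]
      exact ⟨fun h => absurd h (by simp), fun h => absurd h.1 hfin⟩

theorem initSeg_getD_eq_one {A : Set ℕ} {k i : ℕ} :
    Nat.beq ((initSeg A k).getD i 0) 1 = true ↔ i < k ∧ i ∈ A := by
  rw [Nat.beq_eq]
  by_cases hi : i < k
  · have : (initSeg A k).getD i 0 = chi A i := by simp [initSeg, List.getD, hi]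
    rw [this, chi_eq_one_iff]
    exact ⟨fun h => ⟨hi, h⟩, fun h => h.2⟩
  · rw [List.getD_eq_default _ _ (by simp [initSeg]; omega)]
    exact ⟨fun h => absurd h (by simp), fun h => absurd h.1 hi⟩

theorem RankedProcess.oneReducible_bJump {n : ℕ} {h : ℕ → ℕ → Bool}
    {r : ℕ → ℕ → List ℕ} (H : RankedProcess (n + 1) h r) {X B : Set ℕ}
    (hV : TTRed (finalStages r X) (_root_.bJump B)) : oneReducible X (_root_.bJump (_root_.bJump B)) := by
  obtain ⟨u, d, hu, hd, hV⟩ := hV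
  set A := _root_.bJump B
  have hsu : Computable fun w => sentinel (u w) := computable_sentinel.comp hu
  set P : ℕ → List ℕ → Bool := fun w σ => Nat.beq (σ.getD (sentinel (u w)) 0) 1 &&
    d w ((List.range (u w)).map fun i => Nat.beq (σ.getD i 0) 1) with hP
  have hPc : Computable₂ P := by
    refine computable_and (computable_decide_eq (computable_listGetD 0 Computable.snd
      (hsu.comp Computable.fst)) (Computable.const 1)) (hd.comp Computable.fst
        (computable_map_range (hu.comp Computable.fst) ?_))
    exact computable_decide_eq (computable_listGetD 0 (Computable.snd.comp Computable.fst)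
      Computable.snd) (Computable.const 1)
  have hPiff : ∀ w v k, P w (initSeg (restrictTo A v) k) = true ↔
      (sentinel (u w) < k ∧ sentinel (u w) ≤ v) ∧ w ∈ finalStages r X := by
    intro w v k
    simp only [hP, Bool.and_eq_true, initSeg_getD_eq_one]
    have h1 : (sentinel (u w) < k ∧ sentinel (u w) ∈ restrictTo A v) ↔
        (sentinel (u w) < k ∧ sentinel (u w) ≤ v) :=
      and_congr_right fun _ => ⟨fun h => h.2, fun h => ⟨sentinel_mem_bJump _ _, h⟩⟩
    rw [h1, hV]
    refine and_congr_right fun h2 => ?_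
    have h3 : (List.range (u w)).map (fun i =>
        Nat.beq ((initSeg (restrictTo A v) k).getD i 0) 1) = initSegB A (u w) := by
      refine List.map_congr_left fun i hi => ?_
      rw [Bool.eq_iff_iff, initSeg_getD_eq_one, decide_eq_true_iff]
      have h4 := le_sentinel (u w)
      have h5 := List.mem_range.1 hi
      exact ⟨fun h => h.2.1, fun h => ⟨by omega, h, by omega⟩⟩
    rw [h3]
  obtain ⟨Θ, hΘ⟩ := exists_code_of_partrec (f := fun N => Nat.rfind fun s => Part.some
      (P (Nat.pair N.unpair.1.unpair.1 s) (Denumerable.ofNat (List ℕ) N.unpair.2.unpair.1)))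
    (partrec_rfind_some (hPc.comp (computable_natPair
      (computable_unpair_fst (computable_unpair_fst Computable.fst)) Computable.snd)
      ((Computable.ofNat _).comp (computable_unpair_fst (computable_unpair_snd Computable.fst)))))
  have hG : Partrec fun N : ℕ => (Nat.rfind fun s => Part.some
      (Nat.beq (r N.unpair.1.unpair.1 s).headI N.unpair.1.unpair.2)).map fun s =>
        sentinel (u (Nat.pair N.unpair.1.unpair.1 s)) := by
    have hN : Computable fun q : ℕ × ℕ => q.1.unpair.1.unpair.1 :=
      computable_unpair_fst (computable_unpair_fst Computable.fst)
    refine Partrec.map (partrec_rfind_some (computable_decide_eq (computable_headI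
      (H.computable_rank.comp hN Computable.snd))
      (computable_unpair_snd (computable_unpair_fst Computable.fst)))) ?_
    exact hsu.comp (computable_natPair hN Computable.snd)
  obtain ⟨G, hG⟩ := exists_code_of_partrec hG
  set M : ℕ → ℕ := fun x => ∑ c ∈ Finset.range ((r x 0).headI + 1),
    Encodable.encode (G.curry (Nat.pair x c))
  have hM : Computable M := computable_sum_range (computable_add (computable_headI
    (H.computable_rank.comp Computable.id (Computable.const 0))) (Computable.const 1))
    (computable_encode_curry G (computable_natPair Computable.fst Computable.snd))
  refine ⟨fun x => Encodable.encode (Θ.curry (Nat.pair x (M x))),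
    computable_encode_curry Θ (computable_natPair Computable.id hM),
    fun x x' hxx' => (Nat.pair_eq_pair.1 (encode_curry_injective Θ hxx')).1, fun x => ?_⟩
  rw [mem_bJump_iff]
  simp only [phi_encode_curry, hΘ, Nat.unpair_pair, Denumerable.ofNat_encode]
  constructor
  · intro hx
    obtain ⟨c, hc0, hcs, hc⟩ := H.exists_final_head x
    obtain ⟨s, hs⟩ := exists_mem_rfind_some (p := fun s => Nat.beq (r x s).headI c)
      (hcs.imp fun s hs => beq_iff.2 hs)
    have hsc : (r x s).headI = c := beq_iff.1 (mem_rfind_some.1 hs).1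
    have hw : Nat.pair x s ∈ finalStages r X := by
      simp only [finalStages, Set.mem_ofPred_eq, Nat.unpair_pair]
      exact ⟨fun t ht => ((hc s).2 hsc t ht).trans hsc.symm, hx⟩
    refine ⟨Encodable.encode (G.curry (Nat.pair x c)), ?_, sentinel (u (Nat.pair x s)), ?_,
      sentinel (u (Nat.pair x s)) + 1, ?_⟩
    · refine le_trans ?_ ((Nat.right_le_pair x (M x)).trans (le_encode_curry Θ _))
      exact Finset.single_le_sum (f := fun c => Encodable.encode (G.curry (Nat.pair x c)))
        (fun _ _ => Nat.zero_le _) (Finset.mem_range.2 (Nat.lt_succ_of_le hc0))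
    · rw [phi_encode_curry, hG]
      simp only [Nat.unpair_pair]
      exact (Part.mem_map_iff _).2 ⟨s, hs, rfl⟩
    · obtain ⟨t, ht⟩ := exists_mem_rfind_some (p := fun t => P (Nat.pair x t)
          (initSeg (restrictTo A (sentinel (u (Nat.pair x s)))) (sentinel (u (Nat.pair x s)) + 1)))
        ⟨s, (hPiff _ _ _).2 ⟨⟨Nat.lt_succ_self _, le_rfl⟩, hw⟩⟩
      exact Part.dom_iff_mem.2 ⟨t, ht⟩
  · rintro ⟨-, -, v, -, k, hk⟩
    obtain ⟨s, hs⟩ := Part.dom_iff_mem.1 hk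
    have h1 := ((hPiff _ _ _).1 (mem_rfind_some.1 hs).1).2.2
    rwa [Nat.unpair_pair] at h1

theorem HasApprox.oneReducible_bIter_succ {n : ℕ} (hn : 1 ≤ n)
    (hred : ∀ V, HasApprox n V → TTRed V (bIter n)) {X : Set ℕ} (hX : HasApprox (n + 1) X) :
    oneReducible X (bIter (n + 1)) := by
  obtain ⟨h, r, H, hlim⟩ := hX
  have hV := hred _ (H.hasApprox_finalStages hn hlim)
  obtain ⟨m, rfl⟩ := Nat.exists_eq_add_of_le' hn
  exact H.oneReducible_bJump hV

theorem HasApprox.ttRed_bIter {n : ℕ} (hn : 1 ≤ n) {X : Set ℕ} (hX : HasApprox n X) :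
    TTRed X (bIter n) := by
  induction n, hn using Nat.le_induction generalizing X with
  | base => exact ttRed_bJump_of_hasApprox_one hX ∅
  | succ n hn ih => exact .of_oneReducible (hX.oneReducible_bIter_succ hn fun V hV => ih hV)

theorem HasApprox.oneReducible_bIter {n : ℕ} (hn : 2 ≤ n) {X : Set ℕ} (hX : HasApprox n X) :
    oneReducible X (bIter n) := by
  obtain ⟨m, rfl⟩ := Nat.exists_eq_add_of_le' (one_le_two.trans hn)
  exact hX.oneReducible_bIter_succ (by omega) fun V hV => hV.ttRed_bIter (by omega)

end Reductions

end BoundedJump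

/-- For any `X ⊆ ℕ` and `n ≥ 2`: `X ≤_bT ∅^{nb}` iff `X` is `ω^n`-c.e. iff `X ≤₁ ∅^{nb}`. -/
theorem bT_iff_omegaCE_iff_oneReducible (X : Set ℕ) (n : ℕ) (hn : 2 ≤ n) :
    (bTReducible X (bIter n) ↔ OmegaCE n X) ∧
    (OmegaCE n X ↔ oneReducible X (bIter n)) := by
  have h1 : bTReducible X (bIter n) → OmegaCE n X := fun h =>
    ((BoundedJump.hasApprox_bIter (one_le_two.trans hn)).of_bTReducible hn h).omegaCE
  have h2 : OmegaCE n X → oneReducible X (bIter n) := fun h =>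
    (BoundedJump.OmegaCE.hasApprox h).oneReducible_bIter hn
  have h3 : oneReducible X (bIter n) → bTReducible X (bIter n) :=
    BoundedJump.oneReducible.bTReducible
  exact ⟨⟨h1, h3 ∘ h2⟩, h2, h1 ∘ h3⟩
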